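/- For all integers n ≥ 2, d ≥ 2, and m > n^(4d+13), consider the process UNFAIR(m,n,d). There exist constants C₁, C₂ (independent of n, m) such that for every i with 1 ≤ i ≤ n, the expected load of the i-th least-loaded bin after all m balls are placed satisfies |E[b_{i(m)}(m)] − ((i/n)^d − ((i−1)/n)^d)·m| ≤ C₁·m/n^(d+1), and moreover the probability that simultaneously for all i ∈ {1,…,n} the load b_{i(m)}(m) is within C₁·m/n^(d+1) of its expectation is at least 1 − C₂·n^(−d). -/

import Mathlib

namespace Unfair

/-- Loads of the `n` bins, starting from `init`, after the balls recorded in `l`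
have been placed (each entry of `l` is the bin that received a ball). -/
def loadsOf (n : ℕ) (init : Fin n → ℕ) (l : List (Fin n)) : Fin n → ℕ :=
  fun b => init b + l.count b

/-- One step of UNFAIR: draw `d` options uniformly from `{1,…,n}^d` (with replacement)
and return the most-loaded option bin, ties broken uniformly at random. -/
noncomputable def stepBin (n d : ℕ) (hn : 0 < n) (hd : 0 < d) (L : Fin n → ℕ) :
    PMF (Fin n) :=
  haveI : NeZero n := ⟨hn.ne'⟩
  haveI : NeZero d := ⟨hd.ne'⟩
  (PMF.uniformOfFintype (Fin d → Fin n)).bind fun opts =>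
    PMF.uniformOfFinset
      ((Finset.univ.image opts).filter fun b => ∀ k, L (opts k) ≤ L b)
      (by
        classical
        obtain ⟨b, hb, hmax⟩ := Finset.exists_max_image (Finset.univ.image opts) L
          (Finset.univ_nonempty.image opts)
        exact ⟨b, Finset.mem_filter.2 ⟨hb, fun k =>
          hmax _ (Finset.mem_image_of_mem _ (Finset.mem_univ k))⟩⟩)

/-- The permutations of `Fin n` that sort the loads `L`: `σ` maps rank (0-indexed,
least-loaded first) to bin, so `L ∘ σ` is monotone. -/
noncomputable def compatPerms (n : ℕ) (L : Fin n → ℕ) : Finset (Equiv.Perm (Fin n)) :=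
  @Finset.filter _ (fun σ => Monotone fun i => L (σ i)) (Classical.decPred _) Finset.univ

/-- A uniformly random ranking of the bins by load, ties broken uniformly at random:
a uniform element of the sorting permutations of `L`. -/
noncomputable def rankPMF (n : ℕ) (L : Fin n → ℕ) : PMF (Equiv.Perm (Fin n)) :=
  PMF.uniformOfFinset (compatPerms n L)
    ⟨Tuple.sort L, by
      simp only [compatPerms, Finset.mem_filter, Finset.mem_univ, true_and]
      exact Tuple.monotone_sort L⟩

/-- The UNFAIR process, run for `m` steps from initial loads `init`.  The outcome is the
history: at each step we record the bin that received the ball together with a uniformly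
random load-ranking of the bins (ties broken uniformly at random) just after that step. -/
noncomputable def proc (n d : ℕ) (hn : 0 < n) (hd : 0 < d) (init : Fin n → ℕ) :
    ℕ → PMF (List (Fin n × Equiv.Perm (Fin n)))
  | 0 => PMF.pure []
  | (m + 1) => (proc n d hn hd init m).bind fun hist =>
      (stepBin n d hn hd (loadsOf n init (hist.map Prod.fst))).bind fun b =>
        (rankPMF n (loadsOf n init (hist.map Prod.fst ++ [b]))).bind fun σ =>
          PMF.pure (hist ++ [(b, σ)])

/-- The loads at time `t` along a history `h`. -/
def trajLoads (n : ℕ) (init : Fin n → ℕ) (h : List (Fin n × Equiv.Perm (Fin n)))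
    (t : ℕ) : Fin n → ℕ :=
  loadsOf n init ((h.map Prod.fst).take t)

/-- The ranking permutation at time `s ≥ 1` along a history `h`
(maps rank, 0-indexed least-loaded first, to bin). -/
def trajRank (n : ℕ) (h : List (Fin n × Equiv.Perm (Fin n))) (s : ℕ) :
    Equiv.Perm (Fin n) :=
  (h.map Prod.snd).getD (s - 1) 1

/-- The load of the `i`-th least-loaded bin (0-indexed) for loads `L`. -/
noncomputable def sortedLoad (n : ℕ) (L : Fin n → ℕ) (i : Fin n) : ℕ :=
  L (Tuple.sort L i)

/-- Expectation of `f` under the distribution `p`. -/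
noncomputable def pexp {α : Type*} (p : PMF α) (f : α → ℝ) : ℝ :=
  ∑' a, (p a).toReal * f a

/-- Probability of the event `S` under the distribution `p`, as a real number. -/
noncomputable def prob {α : Type*} (p : PMF α) (S : Set α) : ℝ :=
  (p.toOuterMeasure S).toReal

/-! ### Expectations over finitely supported distributions -/

lemma pexp_eq_sum {α : Type*} (p : PMF α) (f : α → ℝ) (T : Finset α)
    (hT : ∀ a, a ∉ T → p a = 0) : pexp p f = ∑ a ∈ T, (p a).toReal * f a := by
  unfold pexp
  apply tsum_eq_sum
  intro a ha
  simp [hT a ha]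

lemma sum_toReal_eq_one {α : Type*} (p : PMF α) (T : Finset α)
    (hT : ∀ a, a ∉ T → p a = 0) : ∑ a ∈ T, (p a).toReal = 1 := by
  have h : ∑' a, p a = ∑ a ∈ T, p a := tsum_eq_sum (fun a ha => hT a ha)
  rw [← ENNReal.toReal_sum (fun a _ => p.apply_ne_top a), ← h, p.tsum_coe, ENNReal.toReal_one]

lemma not_mem_supp {α : Type*} (p : PMF α) (h : p.support.Finite) :
    ∀ a, a ∉ h.toFinset → p a = 0 := by
  intro a ha
  simpa using ha

lemma pexp_mono {α : Type*} (p : PMF α) (hp : p.support.Finite) (f g : α → ℝ)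
    (h : ∀ a ∈ p.support, f a ≤ g a) : pexp p f ≤ pexp p g := by
  rw [pexp_eq_sum p f _ (not_mem_supp p hp), pexp_eq_sum p g _ (not_mem_supp p hp)]
  apply Finset.sum_le_sum
  intro a ha
  exact mul_le_mul_of_nonneg_left (h a (by simpa using ha)) ENNReal.toReal_nonneg

lemma pexp_affine {α : Type*} (p : PMF α) (hp : p.support.Finite) (f : α → ℝ) (a b : ℝ) :
    pexp p (fun x => a * f x + b) = a * pexp p f + b := by
  rw [pexp_eq_sum p f _ (not_mem_supp p hp), pexp_eq_sum p _ _ (not_mem_supp p hp)]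
  have h1 := sum_toReal_eq_one p _ (not_mem_supp p hp)
  calc _ = ∑ x ∈ hp.toFinset, (a * ((p x).toReal * f x) + (p x).toReal * b) := by
        apply Finset.sum_congr rfl; intros; ring
    _ = _ := by rw [Finset.sum_add_distrib, ← Finset.mul_sum, ← Finset.sum_mul, h1, one_mul]

lemma pexp_const {α : Type*} (p : PMF α) (hp : p.support.Finite) (b : ℝ) :
    pexp p (fun _ => b) = b := by
  have := pexp_affine p hp (fun _ => 0) 0 b
  simpa using this

lemma finite_bind {α β : Type*} (p : PMF α) (q : α → PMF β) (hp : p.support.Finite)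
    (hq : ∀ a, (q a).support.Finite) : (p.bind q).support.Finite := by
  rw [PMF.support_bind]
  exact hp.biUnion (fun a _ => hq a)

lemma pexp_bind {α β : Type*} (p : PMF α) (q : α → PMF β) (hp : p.support.Finite)
    (hq : ∀ a, (q a).support.Finite) (f : β → ℝ) :
    pexp (p.bind q) f = pexp p (fun a => pexp (q a) f) := by
  have hb := finite_bind p q hp hq
  rw [pexp_eq_sum (p.bind q) f _ (not_mem_supp _ hb), pexp_eq_sum p _ _ (not_mem_supp p hp)]
  have h1 : ∀ a ∈ hp.toFinset, (p a).toReal * pexp (q a) f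
      = ∑ b ∈ hb.toFinset, (p a).toReal * ((q a b).toReal * f b) := by
    intro a ha
    rw [pexp_eq_sum (q a) f hb.toFinset, Finset.mul_sum]
    intro b hbn
    by_contra hne
    apply hbn
    rw [Set.Finite.mem_toFinset, PMF.mem_support_bind_iff]
    exact ⟨a, by simpa using ha, hne⟩
  rw [Finset.sum_congr rfl h1, Finset.sum_comm]
  apply Finset.sum_congr rfl
  intro b _
  rw [PMF.bind_apply, tsum_eq_sum (s := hp.toFinset), ENNReal.toReal_sum, Finset.sum_mul]
  · apply Finset.sum_congr rfl
    intro a _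
    rw [ENNReal.toReal_mul, mul_assoc]
  · intro a _
    exact ENNReal.mul_ne_top (p.apply_ne_top a) ((q a).apply_ne_top b)
  · intro a ha
    rw [not_mem_supp p hp a ha, zero_mul]

lemma pexp_le_prob {α : Type*} (p : PMF α) (hp : p.support.Finite) (f : α → ℝ) (S : Set α)
    (h1 : ∀ a ∈ p.support, a ∈ S → f a ≤ 1) (h2 : ∀ a ∈ p.support, a ∉ S → f a ≤ 0) :
    pexp p f ≤ prob p S := by
  classical
  have hS : prob p S = pexp p (S.indicator fun _ => 1) := by
    unfold prob
    rw [PMF.toOuterMeasure_apply, tsum_eq_sum (s := hp.toFinset), ENNReal.toReal_sum,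
      pexp_eq_sum p _ _ (not_mem_supp p hp)]
    · apply Finset.sum_congr rfl
      intro a _
      by_cases ha : a ∈ S <;> simp [ha]
    · intro a _
      by_cases ha : a ∈ S <;> simp [ha, p.apply_ne_top a]
    · intro a ha
      by_cases haS : a ∈ S <;> simp [haS, not_mem_supp p hp a ha]
  rw [hS]
  apply pexp_mono p hp
  intro a ha
  by_cases haS : a ∈ S
  · simpa [haS] using h1 a ha haS
  · simpa [haS] using h2 a ha haS

/-! ### The rank weights -/

/-- Probability that the largest of `d` uniform ranks is `i` (0-indexed). -/
noncomputable def wt (n d : ℕ) (i : Fin n) : ℝ :=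
  ((((i : ℕ) : ℝ) + 1) / n) ^ d - (((i : ℕ) : ℝ) / n) ^ d

lemma pow_diff_mono (d : ℕ) : ∀ a b : ℝ, 0 ≤ a → a ≤ b →
    0 ≤ (a + 1) ^ d - a ^ d ∧ (a + 1) ^ d - a ^ d ≤ (b + 1) ^ d - b ^ d := by
  induction d with
  | zero => intro a b _ _; simp
  | succ d ih =>
    intro a b ha hab
    obtain ⟨h1, h2⟩ := ih a b ha hab
    have e : ∀ x : ℝ, (x + 1) ^ (d + 1) - x ^ (d + 1)
        = (x + 1) * ((x + 1) ^ d - x ^ d) + x ^ d := by intro x; ring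
    rw [e, e]
    have h3 : a ^ d ≤ b ^ d := pow_le_pow_left₀ ha hab d
    have h4 : 0 ≤ a ^ d := pow_nonneg ha d
    constructor
    · positivity
    · have : (a + 1) * ((a + 1) ^ d - a ^ d) ≤ (b + 1) * ((b + 1) ^ d - b ^ d) :=
        mul_le_mul (by linarith) h2 h1 (by linarith)
      linarith

lemma wt_mono (n d : ℕ) : Monotone (wt n d) := by
  intro i j hij
  have hij' : ((i : ℕ) : ℝ) ≤ ((j : ℕ) : ℝ) := by exact_mod_cast hij
  have h := (pow_diff_mono d (i : ℕ) (j : ℕ) (by positivity) hij').2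
  unfold wt
  simp only [div_pow, ← sub_div]
  gcongr

/-- The largest option, in terms of ranks. -/
noncomputable def top (n d : ℕ) (hd : 0 < d) (r : Fin d → Fin n) : Fin n :=
  haveI : NeZero d := ⟨hd.ne'⟩
  Finset.univ.sup' Finset.univ_nonempty r

lemma top_le_iff (n d : ℕ) (hd : 0 < d) (r : Fin d → Fin n) (i : Fin n) :
    top n d hd r ≤ i ↔ ∀ k, r k ≤ i := by
  simp [top]

lemma top_lt_iff (n d : ℕ) (hd : 0 < d) (r : Fin d → Fin n) (i : Fin n) :
    top n d hd r < i ↔ ∀ k, r k < i := by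
  simp [top]

lemma top_mem (n d : ℕ) (hd : 0 < d) (r : Fin d → Fin n) : ∃ k, top n d hd r = r k := by
  haveI : NeZero d := ⟨hd.ne'⟩
  obtain ⟨k, _, hk⟩ := Finset.exists_mem_eq_sup' (Finset.univ_nonempty (α := Fin d)) r
  exact ⟨k, hk⟩

lemma card_top (n d : ℕ) (hd : 0 < d) (i : Fin n) :
    ((Finset.univ.filter fun r : Fin d → Fin n => top n d hd r = i).card : ℝ)
      = (((i : ℕ) : ℝ) + 1) ^ d - ((i : ℕ) : ℝ) ^ d := by
  classical
  have hle : (Finset.univ.filter fun r : Fin d → Fin n => top n d hd r ≤ i).card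
      = ((i : ℕ) + 1) ^ d := by
    have : (Finset.univ.filter fun r : Fin d → Fin n => top n d hd r ≤ i)
        = Fintype.piFinset (fun _ => Finset.Iic i) := by
      ext r; simp [top_le_iff]
    rw [this, Fintype.card_piFinset]; simp
  have hlt : (Finset.univ.filter fun r : Fin d → Fin n => top n d hd r < i).card
      = (i : ℕ) ^ d := by
    have : (Finset.univ.filter fun r : Fin d → Fin n => top n d hd r < i)
        = Fintype.piFinset (fun _ => Finset.Iio i) := by
      ext r; simp [top_lt_iff]
    rw [this, Fintype.card_piFinset]; simp
  have hsum : (Finset.univ.filter fun r : Fin d → Fin n => top n d hd r ≤ i).card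
      = (Finset.univ.filter fun r : Fin d → Fin n => top n d hd r = i).card
        + (Finset.univ.filter fun r : Fin d → Fin n => top n d hd r < i).card := by
    rw [← Finset.card_union_of_disjoint]
    · congr 1
      ext r; simp [le_iff_eq_or_lt]
    · rw [Finset.disjoint_left]
      intro r h1 h2
      simp only [Finset.mem_filter, Finset.mem_univ, true_and] at h1 h2
      exact absurd h1 h2.ne
  rw [hle, hlt] at hsum
  have this := congrArg (Nat.cast (R := ℝ)) hsum
  push_cast at this
  rw [this]; ring

/-- The expectation of a function of the largest rank of the options. -/
lemma pexp_top (n d : ℕ) (hn : 0 < n) (hd : 0 < d) (σ : Equiv.Perm (Fin n)) (h : Fin n → ℝ) :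
    haveI : NeZero n := ⟨hn.ne'⟩
    pexp (PMF.uniformOfFintype (Fin d → Fin n)) (fun o => h (top n d hd fun k => σ.symm (o k)))
      = ∑ i, wt n d i * h i := by
  classical
  haveI : NeZero n := ⟨hn.ne'⟩
  show pexp (PMF.uniformOfFintype (Fin d → Fin n))
    (fun o => h (top n d hd fun k => σ.symm (o k))) = ∑ i, wt n d i * h i
  rw [pexp_eq_sum _ _ Finset.univ (by simp)]
  simp only [PMF.uniformOfFintype_apply]
  rw [← Finset.mul_sum]
  have h1 : ∑ o : Fin d → Fin n, h (top n d hd fun k => σ.symm (o k))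
      = ∑ r : Fin d → Fin n, h (top n d hd r) :=
    Fintype.sum_equiv (Equiv.arrowCongr (Equiv.refl _) σ.symm) _ _ (fun o => rfl)
  have h2 : ∑ r : Fin d → Fin n, h (top n d hd r)
      = ∑ i, ∑ r ∈ Finset.univ.filter (fun r : Fin d → Fin n => top n d hd r = i), h i := by
    rw [← Finset.sum_fiberwise Finset.univ (fun r => top n d hd r)]
    apply Finset.sum_congr rfl
    intro i _
    apply Finset.sum_congr rfl
    intro r hr
    rw [(Finset.mem_filter.1 hr).2]
  rw [h1, h2, Finset.mul_sum]
  apply Finset.sum_congr rfl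
  intro i _
  rw [Finset.sum_const, nsmul_eq_mul, card_top]
  simp only [wt, div_pow, Fintype.card_fun, Fintype.card_fin, ENNReal.toReal_inv,
    ENNReal.toReal_natCast]
  push_cast
  ring

lemma sum_wt (n d : ℕ) (hn : 0 < n) (hd : 0 < d) : ∑ i, wt n d i = 1 := by
  have h := pexp_top n d hn hd 1 (fun _ => 1)
  haveI : NeZero n := ⟨hn.ne'⟩
  have hconst := pexp_const (PMF.uniformOfFintype (Fin d → Fin n)) (Set.toFinite _) 1
  simp only [mul_one] at h
  rw [← h]; exact hconst

/-! ### The quadratic potential -/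

/-- Squared distance of the sorted loads from `t` times the rank weights. -/
noncomputable def pot (n d : ℕ) (t : ℝ) (L : Fin n → ℕ) : ℝ :=
  ∑ i, ((sortedLoad n L i : ℝ) - wt n d i * t) ^ 2

lemma pot_eq (n d : ℕ) (t : ℝ) (L : Fin n → ℕ) :
    pot n d t L = ∑ b, (L b : ℝ) ^ 2 - 2 * t * ∑ i, wt n d i * (sortedLoad n L i : ℝ)
      + t ^ 2 * ∑ i, wt n d i ^ 2 := by
  have h : ∑ b, (L b : ℝ) ^ 2 = ∑ i, (sortedLoad n L i : ℝ) ^ 2 :=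
    (Equiv.sum_comp (Tuple.sort L) (fun b => (L b : ℝ) ^ 2)).symm
  rw [h, pot, Finset.mul_sum, Finset.mul_sum, ← Finset.sum_sub_distrib, ← Finset.sum_add_distrib]
  apply Finset.sum_congr rfl
  intro i _
  ring

lemma rearr (n d : ℕ) (L : Fin n → ℕ) (π : Equiv.Perm (Fin n)) :
    ∑ i, wt n d i * (L (π i) : ℝ) ≤ ∑ i, wt n d i * (sortedLoad n L i : ℝ) := by
  have hm : Monovary (wt n d) (fun i => (sortedLoad n L i : ℝ)) := by
    apply Monotone.monovary (wt_mono n d)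
    intro i j hij
    exact Nat.cast_le.2 (Tuple.monotone_sort L hij)
  have h := hm.sum_mul_comp_perm_le_sum_mul (σ := (Tuple.sort L)⁻¹ * π)
  refine le_trans (le_of_eq ?_) h
  apply Finset.sum_congr rfl
  intro i _
  simp [sortedLoad]

lemma sum_step (n d : ℕ) (L L' : Fin n → ℕ) (b : Fin n) (j : Fin n)
    (hL' : ∀ c, L' c = L c + if c = b then 1 else 0)
    (hb : L b = L (Tuple.sort L j)) :
    ∑ i, wt n d i * (sortedLoad n L i : ℝ) + wt n d j
      ≤ ∑ i, wt n d i * (sortedLoad n L' i : ℝ) := by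
  classical
  set σ := Tuple.sort L with hσ
  refine le_trans (le_of_eq ?_) (rearr n d L' (σ.trans (Equiv.swap b (σ j))))
  have h : ∀ i, wt n d i * (L' ((σ.trans (Equiv.swap b (σ j))) i) : ℝ)
      = wt n d i * (sortedLoad n L i : ℝ) + if i = j then wt n d i else 0 := by
    intro i
    rw [hL', Equiv.trans_apply]
    unfold sortedLoad
    rw [← hσ]
    by_cases hij : i = j
    · subst hij
      simp [hb]; ring
    · have h1 : σ i ≠ σ j := fun h => hij (σ.injective h)
      by_cases h2 : σ i = b
      · have h3 : σ j ≠ b := fun h => h1 (h2.trans h.symm)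
        rw [h2, Equiv.swap_apply_left]
        simp [h3, hij, hb]
      · rw [Equiv.swap_apply_of_ne_of_ne h2 h1]
        simp [h2, hij]
  rw [Finset.sum_congr rfl (fun i _ => h i), Finset.sum_add_distrib]
  simp

lemma pot_step (n d : ℕ) (t : ℝ) (ht : 0 ≤ t) (L L' : Fin n → ℕ) (b : Fin n) (j : Fin n)
    (hL' : ∀ c, L' c = L c + if c = b then 1 else 0)
    (hb : L b = L (Tuple.sort L j)) :
    pot n d (t + 1) L' ≤ pot n d t L + 2 * (sortedLoad n L j : ℝ) + 1
      - 2 * (t + 1) * wt n d j - 2 * (∑ i, wt n d i * (sortedLoad n L i : ℝ))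
      + (2 * t + 1) * ∑ i, wt n d i ^ 2 := by
  have h1 := sum_step n d L L' b j hL' hb
  have h2 : ∑ c, (L' c : ℝ) ^ 2 = ∑ c, (L c : ℝ) ^ 2 + (2 * (L b : ℝ) + 1) := by
    have : ∀ c, (L' c : ℝ) ^ 2 = (L c : ℝ) ^ 2 + if c = b then (2 * (L c : ℝ) + 1) else 0 := by
      intro c
      rw [hL']
      by_cases hc : c = b <;> simp [hc]
      ring
    rw [Finset.sum_congr rfl (fun c _ => this c), Finset.sum_add_distrib]
    simp
  rw [pot_eq, pot_eq, h2]
  have h3 : (L b : ℝ) = (sortedLoad n L j : ℝ) := by rw [hb]; rfl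
  rw [h3]
  have h4 := mul_le_mul_of_nonneg_left h1 (by linarith : 0 ≤ 2 * (t + 1))
  nlinarith [h4]

lemma stepBin_finite (n d : ℕ) (hn : 0 < n) (hd : 0 < d) (L : Fin n → ℕ) :
    (stepBin n d hn hd L).support.Finite := Set.toFinite _

lemma pexp_stepBin (n d : ℕ) (hn : 0 < n) (hd : 0 < d) (L : Fin n → ℕ) (t : ℝ) (ht : 0 ≤ t)
    (f : Fin n → ℝ) (L' : Fin n → Fin n → ℕ)
    (hL' : ∀ b c, L' b c = L c + if c = b then 1 else 0)
    (hf : ∀ b, f b ≤ pot n d (t + 1) (L' b)) :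
    pexp (stepBin n d hn hd L) f ≤ pot n d t L + 1 := by
  classical
  haveI : NeZero n := ⟨hn.ne'⟩
  haveI : NeZero d := ⟨hd.ne'⟩
  set σ := Tuple.sort L with hσ
  set P := ∑ i, wt n d i * (sortedLoad n L i : ℝ) with hP
  set Q := ∑ i, wt n d i ^ 2 with hQ
  set H : Fin n → ℝ := fun j => pot n d t L + 2 * (sortedLoad n L j : ℝ) + 1
      - 2 * (t + 1) * wt n d j - 2 * P + (2 * t + 1) * Q with hH
  unfold stepBin
  rw [pexp_bind _ _ (Set.toFinite _) (fun _ => Set.toFinite _)]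
  have hmain : ∀ o : Fin d → Fin n, ∀ b : Fin n, b ∈ Finset.univ.image o →
      (∀ k, L (o k) ≤ L b) → f b ≤ H (top n d hd fun k => σ.symm (o k)) := by
    intro o b hb hmax
    refine (hf b).trans ?_
    apply pot_step n d t ht L (L' b) b _ (hL' b)
    obtain ⟨k, hk⟩ := top_mem n d hd fun k => σ.symm (o k)
    apply le_antisymm
    · obtain ⟨k', _, hk'⟩ := Finset.mem_image.1 hb
      have h1 := (top_le_iff n d hd (fun k => σ.symm (o k)) _).1 le_rfl k'
      have h2 := Tuple.monotone_sort L h1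
      simp only [Function.comp, ← hσ, Equiv.apply_symm_apply, hk'] at h2
      exact h2
    · rw [hk, ← hσ]
      simpa using hmax k
  have hle : pexp (PMF.uniformOfFintype (Fin d → Fin n))
      (fun o => H (top n d hd fun k => σ.symm (o k))) ≤ pot n d t L + 1 := by
    have h := pexp_top n d hn hd σ H
    have hs := sum_wt n d hn hd
    refine (le_of_eq h).trans ?_
    have : ∑ i, wt n d i * H i = (pot n d t L + 1 - 2 * P + (2 * t + 1) * Q) * ∑ i, wt n d i
        + 2 * P - 2 * (t + 1) * Q := by
      have e : ∀ i, wt n d i * H i = (pot n d t L + 1 - 2 * P + (2 * t + 1) * Q) * wt n d i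
          + 2 * (wt n d i * (sortedLoad n L i : ℝ)) - 2 * (t + 1) * wt n d i ^ 2 := by
        intro i
        simp only [hH]
        ring
      rw [Finset.sum_congr rfl (fun i _ => e i), Finset.sum_sub_distrib, Finset.sum_add_distrib,
        ← Finset.mul_sum, ← Finset.mul_sum, ← Finset.mul_sum]
    rw [this, hs]
    have hQ0 : 0 ≤ Q := Finset.sum_nonneg (fun i _ => sq_nonneg _)
    linarith
  refine le_trans (pexp_mono _ (Set.toFinite _) _ _ ?_) hle
  intro o _
  refine le_trans (pexp_mono _ (Set.toFinite _) _
    (fun _ => H (top n d hd fun k => σ.symm (o k))) ?_)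
    (le_of_eq (pexp_const _ (Set.toFinite _) _))
  intro b hb
  rw [PMF.support_uniformOfFinset] at hb
  have hb' := Finset.mem_filter.1 (Finset.mem_coe.1 hb)
  refine hmain o b ?_ hb'.2
  have := hb'.1
  simpa using this

lemma proc_finite (n d : ℕ) (hn : 0 < n) (hd : 0 < d) (m : ℕ) :
    (proc n d hn hd 0 m).support.Finite := by
  induction m with
  | zero => simp [proc]
  | succ m ih =>
    apply finite_bind _ _ ih
    intro h
    apply finite_bind _ _ (Set.toFinite _)
    intro b
    apply finite_bind _ _ (Set.toFinite _)
    intro σ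
    simp

lemma proc_length (n d : ℕ) (hn : 0 < n) (hd : 0 < d) (m : ℕ) :
    ∀ h ∈ (proc n d hn hd 0 m).support, h.length = m := by
  induction m with
  | zero => simp [proc]
  | succ m ih =>
    intro h hh
    simp only [proc, PMF.mem_support_bind_iff, PMF.mem_support_pure_iff] at hh
    obtain ⟨h', hh', b, _, σ, _, rfl⟩ := hh
    simp [ih h' hh']

lemma proc_pot (n d : ℕ) (hn : 0 < n) (hd : 0 < d) (m : ℕ) :
    pexp (proc n d hn hd 0 m) (fun h => pot n d m (loadsOf n 0 (h.map Prod.fst))) ≤ m := by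
  induction m with
  | zero =>
    have : ∀ h ∈ (proc n d hn hd 0 0).support,
        pot n d (0 : ℕ) (loadsOf n 0 (h.map Prod.fst)) ≤ 0 := by
      intro h hh
      have : h = [] := by simpa [proc] using hh
      subst this
      simp [pot, sortedLoad, loadsOf]
    refine (pexp_mono _ (proc_finite n d hn hd 0) _ _ this).trans ?_
    rw [pexp_const _ (proc_finite n d hn hd 0)]
    simp
  | succ m ih =>
    have hfin : ∀ (hist : List (Fin n × Equiv.Perm (Fin n))) (b : Fin n),
        ((rankPMF n (loadsOf n 0 (hist.map Prod.fst ++ [b]))).bind fun σ =>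
          PMF.pure (hist ++ [(b, σ)])).support.Finite := by
      intro hist b
      apply finite_bind _ _ (Set.toFinite _)
      intro σ
      simp
    rw [proc, pexp_bind _ _ (proc_finite n d hn hd m)
      (fun hist => finite_bind _ _ (Set.toFinite _) (fun b => hfin hist b))]
    have key : ∀ hist ∈ (proc n d hn hd 0 m).support,
        pexp ((stepBin n d hn hd (loadsOf n 0 (hist.map Prod.fst))).bind fun b =>
          (rankPMF n (loadsOf n 0 (hist.map Prod.fst ++ [b]))).bind fun σ =>
          PMF.pure (hist ++ [(b, σ)]))
          (fun h => pot n d ((m + 1 : ℕ) : ℝ) (loadsOf n 0 (h.map Prod.fst)))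
        ≤ 1 * pot n d m (loadsOf n 0 (hist.map Prod.fst)) + 1 := by
      intro hist _
      rw [pexp_bind _ _ (Set.toFinite _) (hfin hist), one_mul]
      apply pexp_stepBin n d hn hd _ (m : ℝ) (by positivity) _
        (fun b => loadsOf n 0 (hist.map Prod.fst ++ [b]))
      · intro b c
        simp only [loadsOf, List.count_append, List.count_singleton, add_assoc]
        congr 2
        by_cases hbc : c = b
        · simp [hbc]
        · have : ¬ b = c := fun h => hbc h.symm
          simp [hbc, this]
      · intro b
        rw [pexp_bind _ _ (Set.toFinite _) (by intro σ; simp)]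
        refine le_trans (pexp_mono _ (Set.toFinite _) _
          (fun _ => pot n d ((m : ℝ) + 1) (loadsOf n 0 (hist.map Prod.fst ++ [b]))) ?_)
          (le_of_eq (pexp_const _ (Set.toFinite _) _))
        intro σ _
        rw [pexp_eq_sum _ _ {hist ++ [(b, σ)]}]
        · simp
        · intro a ha
          simpa using ha
    refine (pexp_mono _ (proc_finite n d hn hd m) _ _ key).trans ?_
    rw [pexp_affine _ (proc_finite n d hn hd m)]
    push_cast
    linarith

end Unfair

open Unfair in
/-- **Theorem 1 (main theorem).** For all integers `n ≥ 2`, `d ≥ 2` and `m > n^(4d+13)`,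
under `UNFAIR(m,n,d)` (started from empty bins), there are constants `C₁, C₂`
(depending only on `d`, not on `n, m`) such that for every `1 ≤ i ≤ n` the expected load
of the `i`-th least-loaded bin after `m` balls is within `C₁·m/n^(d+1)` of
`((i/n)^d − ((i−1)/n)^d)·m`, and with probability at least `1 − C₂·n^(−d)` all `n` bins
are simultaneously within `C₁·m/n^(d+1)` of their expectations. -/
theorem unfair_main_theorem :
    ∀ d : ℕ, ∀ hd2 : 2 ≤ d,
    ∃ C₁ C₂ : ℝ, 0 < C₁ ∧ 0 < C₂ ∧
      ∀ n : ℕ, ∀ hn2 : 2 ≤ n, ∀ m : ℕ, n ^ (4 * d + 13) < m →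
        (∀ i : ℕ, ∀ hi1 : 1 ≤ i, ∀ hi2 : i ≤ n,
          |pexp (proc n d (by omega) (by omega) 0 m)
              (fun h => (sortedLoad n (trajLoads n 0 h m) ⟨i - 1, by omega⟩ : ℝ))
            - (((i : ℝ) / n) ^ d - (((i : ℝ) - 1) / n) ^ d) * m|
          ≤ C₁ * m / (n : ℝ) ^ (d + 1)) ∧
        1 - C₂ / (n : ℝ) ^ d ≤
          prob (proc n d (by omega) (by omega) 0 m)
            {h | ∀ i : ℕ, ∀ hi1 : 1 ≤ i, ∀ hi2 : i ≤ n,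
              |(sortedLoad n (trajLoads n 0 h m) ⟨i - 1, by omega⟩ : ℝ)
                - pexp (proc n d (by omega) (by omega) 0 m)
                    (fun h' => (sortedLoad n (trajLoads n 0 h' m) ⟨i - 1, by omega⟩ : ℝ))|
              ≤ C₁ * m / (n : ℝ) ^ (d + 1)} := by
  intro d hd2
  refine ⟨2, 1, by norm_num, by norm_num, ?_⟩
  intro n hn2 m hm
  have hn : 0 < n := by omega
  have hd : 0 < d := by omega
  have hfin := proc_finite n d hn hd m
  have hpot := proc_pot n d hn hd m
  have hlen := proc_length n d hn hd m
  set p := proc n d hn hd 0 m with hp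
  have hn1 : (1 : ℝ) ≤ n := by exact_mod_cast hn
  have hn0 : (0 : ℝ) < n := by linarith
  have hmR : (n : ℝ) ^ (4 * d + 13) ≤ m := by exact_mod_cast hm.le
  have hm0 : (0 : ℝ) < m := lt_of_lt_of_le (by positivity) hmR
  have hm1 : (n : ℝ) ^ (d + 1) * (n : ℝ) ^ (d + 1) ≤ m := by
    rw [← pow_add]
    exact (pow_le_pow_right₀ hn1 (by omega)).trans hmR
  have hm2 : (n : ℝ) ^ (d + 1) * (n : ℝ) ^ (d + 1) * (n : ℝ) ^ d ≤ m := by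
    rw [← pow_add, ← pow_add]
    exact (pow_le_pow_right₀ hn1 (by omega)).trans hmR
  set N : ℝ := (n : ℝ) ^ (d + 1) with hN
  have hN0 : 0 < N := by positivity
  set lam : ℝ := m / N with hlam
  have hlam0 : 0 < lam := by positivity
  have hNlam : N ≤ lam := by
    rw [hlam, le_div_iff₀ hN0]; exact hm1
  have hmlam : (m : ℝ) = N * lam := by rw [hlam]; field_simp
  -- the potential dominates each coordinate
  have hcoord : ∀ h ∈ p.support, ∀ i : Fin n,
      ((sortedLoad n (trajLoads n 0 h m) i : ℝ) - wt n d i * m) ^ 2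
        ≤ pot n d m (loadsOf n 0 (h.map Prod.fst)) := by
    intro h hh i
    have : trajLoads n 0 h m = loadsOf n 0 (h.map Prod.fst) := by
      unfold trajLoads
      rw [List.take_of_length_le]
      simp [hlen h hh]
    rw [this, pot]
    exact Finset.single_le_sum
      (f := fun i => ((sortedLoad n (loadsOf n 0 (h.map Prod.fst)) i : ℝ) - wt n d i * m) ^ 2)
      (fun i _ => sq_nonneg _) (Finset.mem_univ i)
  have hmean : ∀ i : Fin n,
      |pexp p (fun h => (sortedLoad n (trajLoads n 0 h m) i : ℝ)) - wt n d i * m| ≤ lam := by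
    intro i
    have hbound : ∀ y V : ℝ, y ^ 2 ≤ V → |y| ≤ (1 / (2 * lam)) * V + lam / 2 := by
      intro y V hy
      have h1 : |y| ≤ (1 / (2 * lam)) * y ^ 2 + lam / 2 := by
        rw [← sq_abs]
        have : (1 / (2 * lam)) * |y| ^ 2 + lam / 2 - |y| = (|y| - lam) ^ 2 / (2 * lam) := by
          field_simp; ring
        have h0 : 0 ≤ (|y| - lam) ^ 2 / (2 * lam) := by positivity
        linarith
      have h2 : (1 / (2 * lam)) * y ^ 2 ≤ (1 / (2 * lam)) * V :=
        mul_le_mul_of_nonneg_left hy (by positivity)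
      linarith
    have hE : pexp p (fun h => (1 / (2 * lam)) * pot n d m (loadsOf n 0 (h.map Prod.fst))
        + lam / 2) ≤ lam := by
      rw [pexp_affine p hfin]
      have h1 : (1 / (2 * lam)) * pexp p (fun h => pot n d m (loadsOf n 0 (h.map Prod.fst)))
          ≤ (1 / (2 * lam)) * m := mul_le_mul_of_nonneg_left hpot (by positivity)
      have h2 : (1 / (2 * lam)) * (m : ℝ) = N / 2 := by rw [hmlam]; field_simp
      linarith
    have hup := pexp_mono p hfin
      (fun h => 1 * (sortedLoad n (trajLoads n 0 h m) i : ℝ) + (- (wt n d i * m))) _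
      (fun h hh => by
        have := (le_abs_self _).trans (hbound _ _ (hcoord h hh i))
        show _ ≤ (1 / (2 * lam)) * pot n d m (loadsOf n 0 (h.map Prod.fst)) + lam / 2
        linarith)
    have hlo := pexp_mono p hfin
      (fun h => (-1) * (sortedLoad n (trajLoads n 0 h m) i : ℝ) + (wt n d i * m)) _
      (fun h hh => by
        have := (neg_le_abs _).trans (hbound _ _ (hcoord h hh i))
        show _ ≤ (1 / (2 * lam)) * pot n d m (loadsOf n 0 (h.map Prod.fst)) + lam / 2
        linarith)
    rw [pexp_affine p hfin] at hup hlo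
    rw [abs_le]
    constructor <;> linarith
  have hgoal : 2 * (m : ℝ) / N = 2 * lam := by rw [hlam]; ring
  constructor
  · intro i hi1 hi2
    have h := hmean ⟨i - 1, by omega⟩
    have hw : wt n d ⟨i - 1, by omega⟩ = ((i : ℝ) / n) ^ d - (((i : ℝ) - 1) / n) ^ d := by
      simp only [wt]
      rw [Nat.cast_sub hi1]
      simp
    rw [hw] at h
    rw [hgoal]
    exact h.trans (by linarith)
  · have hE : 1 - 1 / (n : ℝ) ^ d ≤
        pexp p (fun h => (-(1 / lam ^ 2)) * pot n d m (loadsOf n 0 (h.map Prod.fst)) + 1) := by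
      rw [pexp_affine p hfin]
      have h1 : (1 / lam ^ 2) * pexp p (fun h => pot n d m (loadsOf n 0 (h.map Prod.fst)))
          ≤ (1 / lam ^ 2) * m := mul_le_mul_of_nonneg_left hpot (by positivity)
      have h2 : (1 / lam ^ 2) * (m : ℝ) ≤ 1 / (n : ℝ) ^ d := by
        have : (1 / lam ^ 2) * (m : ℝ) = N * N / m := by rw [hlam]; field_simp
        rw [this, div_le_div_iff₀ hm0 (by positivity)]
        linarith
      linarith
    refine hE.trans (pexp_le_prob p hfin _ _ ?_ ?_)
    · intro h _ _
      have : 0 ≤ pot n d m (loadsOf n 0 (h.map Prod.fst)) :=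
        Finset.sum_nonneg (fun i _ => sq_nonneg _)
      have : 0 ≤ (1 / lam ^ 2) * pot n d m (loadsOf n 0 (h.map Prod.fst)) := by positivity
      linarith
    · intro h hh hS
      by_contra hcon
      push Not at hcon
      apply hS
      have hlt : pot n d m (loadsOf n 0 (h.map Prod.fst)) < lam ^ 2 := by
        have h1 : (1 / lam ^ 2) * pot n d m (loadsOf n 0 (h.map Prod.fst)) < 1 := by linarith
        rw [one_div, inv_mul_lt_iff₀ (by positivity)] at h1
        linarith
      intro i hi1 hi2
      have h1 := abs_lt_of_sq_lt_sq ((hcoord h hh ⟨i - 1, by omega⟩).trans_lt hlt) hlam0.le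
      have h2 := hmean ⟨i - 1, by omega⟩
      rw [abs_le] at h2
      rw [abs_lt] at h1
      rw [hgoal, abs_le]
      constructor <;> linarith [h1.1, h1.2, h2.1, h2.2]
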